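/- Let (u_k) be a sequence of continuous functions on Ω, each nonnegative and a subsolution of −Δu + |u|^{q−1}u = 0. Then U(x) := sup_k u_k(x) is finite at every point of Ω, locally bounded in Ω, and U is a subsolution of the equation in Ω. -/

import Mathlib

open MeasureTheory Set Filter

noncomputable section

def laplacian {N : ℕ} (φ : EuclideanSpace ℝ (Fin N) → ℝ) (x : EuclideanSpace ℝ (Fin N)) : ℝ :=
  ∑ i : Fin N, iteratedFDeriv ℝ 2 φ x ![EuclideanSpace.single i 1, EuclideanSpace.single i 1]

def IsTestFun {N : ℕ} (Ω : Set (EuclideanSpace ℝ (Fin N))) (φ : EuclideanSpace ℝ (Fin N) → ℝ) : Prop :=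
  ContDiff ℝ (⊤ : ℕ∞) φ ∧ HasCompactSupport φ ∧ tsupport φ ⊆ Ω

def MemLqLoc {N : ℕ} (q : ℝ) (Ω : Set (EuclideanSpace ℝ (Fin N)))
    (u : EuclideanSpace ℝ (Fin N) → ℝ) : Prop :=
  AEStronglyMeasurable u (volume.restrict Ω) ∧
  ∀ K : Set (EuclideanSpace ℝ (Fin N)), K ⊆ Ω → IsCompact K →
    IntegrableOn (fun x => |u x| ^ q) K volume

def MemLinftyLoc {N : ℕ} (Ω : Set (EuclideanSpace ℝ (Fin N)))
    (u : EuclideanSpace ℝ (Fin N) → ℝ) : Prop :=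
  AEStronglyMeasurable u (volume.restrict Ω) ∧
  ∀ K : Set (EuclideanSpace ℝ (Fin N)), K ⊆ Ω → IsCompact K →
    ∃ M : ℝ, ∀ᵐ x ∂(volume.restrict K), |u x| ≤ M

def IsSubsolution {N : ℕ} (q : ℝ) (Ω : Set (EuclideanSpace ℝ (Fin N)))
    (u : EuclideanSpace ℝ (Fin N) → ℝ) : Prop :=
  MemLqLoc q Ω u ∧
  ∀ φ : EuclideanSpace ℝ (Fin N) → ℝ, IsTestFun Ω φ → (∀ x, 0 ≤ φ x) →
    (∫ x in Ω, (-(u x) * laplacian φ x + |u x| ^ (q - 1) * u x * φ x)) ≤ 0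

def IsSupersolution {N : ℕ} (q : ℝ) (Ω : Set (EuclideanSpace ℝ (Fin N)))
    (u : EuclideanSpace ℝ (Fin N) → ℝ) : Prop :=
  MemLqLoc q Ω u ∧
  ∀ φ : EuclideanSpace ℝ (Fin N) → ℝ, IsTestFun Ω φ → (∀ x, 0 ≤ φ x) →
    0 ≤ (∫ x in Ω, (-(u x) * laplacian φ x + |u x| ^ (q - 1) * u x * φ x))

def IsSolution {N : ℕ} (q : ℝ) (Ω : Set (EuclideanSpace ℝ (Fin N)))
    (u : EuclideanSpace ℝ (Fin N) → ℝ) : Prop :=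
  MemLqLoc q Ω u ∧
  ∀ φ : EuclideanSpace ℝ (Fin N) → ℝ, IsTestFun Ω φ →
    (∫ x in Ω, (-(u x) * laplacian φ x + |u x| ^ (q - 1) * u x * φ x)) = 0

section Smooth

variable {N : ℕ}

local notation "𝔼" => EuclideanSpace ℝ (Fin N)

/-- The derivative of `f` in the direction `v`, as a function of the base point. -/
def dirDeriv (v : 𝔼) (f : 𝔼 → ℝ) (x : 𝔼) : ℝ := fderiv ℝ f x v

lemma contDiff_dirDeriv {f : 𝔼 → ℝ} (hf : ContDiff ℝ (⊤ : ℕ∞) f) (v : 𝔼) :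
    ContDiff ℝ (⊤ : ℕ∞) (dirDeriv v f) :=
  (hf.fderiv_right (m := ((⊤ : ℕ∞) : WithTop ℕ∞)) (by norm_cast)).clm_apply contDiff_const

lemma hasCompactSupport_dirDeriv {f : 𝔼 → ℝ} (hf : HasCompactSupport f) (v : 𝔼) :
    HasCompactSupport (dirDeriv v f) :=
  hf.fderiv_apply ℝ v

lemma tsupport_dirDeriv_subset (f : 𝔼 → ℝ) (v : 𝔼) : tsupport (dirDeriv v f) ⊆ tsupport f :=
  tsupport_fderiv_apply_subset ℝ v

lemma hasDerivAt_line {f : 𝔼 → ℝ} (hf : ContDiff ℝ (⊤ : ℕ∞) f) (x v : 𝔼) (t : ℝ) :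
    HasDerivAt (fun s : ℝ => f (x + s • v)) (dirDeriv v f (x + t • v)) t := by
  have h1 : HasFDerivAt f (fderiv ℝ f (x + t • v)) (x + t • v) :=
    (hf.differentiable (by simp) _).hasFDerivAt
  have h2 : HasDerivAt (fun s : ℝ => x + s • v) v t := by
    simpa using ((hasDerivAt_id t).smul_const v).const_add x
  exact h1.comp_hasDerivAt t h2

lemma dirDeriv_eq_of_hasDerivAt {f : 𝔼 → ℝ} (hf : ContDiff ℝ (⊤ : ℕ∞) f) {x v : 𝔼} {a : ℝ}
    (h : HasDerivAt (fun s : ℝ => f (x + s • v)) a 0) : dirDeriv v f x = a := by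
  have := (hasDerivAt_line hf x v 0).unique h
  simpa using this

lemma laplacian_eq_sum_dirDeriv {f : 𝔼 → ℝ} (hf : ContDiff ℝ (⊤ : ℕ∞) f) (x : 𝔼) :
    laplacian f x = ∑ i : Fin N, dirDeriv (EuclideanSpace.single i 1)
      (dirDeriv (EuclideanSpace.single i 1) f) x := by
  refine Finset.sum_congr rfl fun i _ => ?_
  rw [iteratedFDeriv_two_apply]
  have hd : DifferentiableAt ℝ (fderiv ℝ f) x :=
    (hf.fderiv_right (m := ((⊤ : ℕ∞) : WithTop ℕ∞)) (by norm_cast)).differentiable (by simp) x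
  have := (hd.hasFDerivAt.clm_apply
    (hasFDerivAt_const (EuclideanSpace.single i (1 : ℝ) : 𝔼) x)).fderiv
  change _ = fderiv ℝ (fun y => fderiv ℝ f y (EuclideanSpace.single i 1)) x
    (EuclideanSpace.single i 1)
  rw [this]
  simp

lemma laplacian_eq_sum_dirDeriv' {f : 𝔼 → ℝ} (hf : ContDiff ℝ (⊤ : ℕ∞) f) :
    laplacian f = fun x => ∑ i : Fin N, dirDeriv (EuclideanSpace.single i 1)
      (dirDeriv (EuclideanSpace.single i 1) f) x :=
  funext (laplacian_eq_sum_dirDeriv hf)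

lemma continuous_laplacian {f : 𝔼 → ℝ} (hf : ContDiff ℝ (⊤ : ℕ∞) f) :
    Continuous (laplacian f) := by
  rw [laplacian_eq_sum_dirDeriv' hf]
  exact continuous_finsetSum _ fun i _ =>
    (contDiff_dirDeriv (contDiff_dirDeriv hf _) _).continuous

lemma laplacian_eq_zero_of_notMem_tsupport {f : 𝔼 → ℝ} (hf : ContDiff ℝ (⊤ : ℕ∞) f) {x : 𝔼}
    (hx : x ∉ tsupport f) : laplacian f x = 0 := by
  rw [laplacian_eq_sum_dirDeriv hf]
  refine Finset.sum_eq_zero fun i _ => image_eq_zero_of_notMem_tsupport fun h => hx ?_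
  exact tsupport_dirDeriv_subset _ _ (tsupport_dirDeriv_subset _ _ h)

lemma integral_mul_dirDeriv {f g : 𝔼 → ℝ} (hf : ContDiff ℝ (⊤ : ℕ∞) f)
    (hg : ContDiff ℝ (⊤ : ℕ∞) g) (hc : HasCompactSupport f ∨ HasCompactSupport g) (v : 𝔼) :
    ∫ x, f x * dirDeriv v g x = -∫ x, dirDeriv v f x * g x := by
  have key : ∀ {a b : 𝔼 → ℝ}, Continuous a → Continuous b →
      (HasCompactSupport a ∨ HasCompactSupport b) → Integrable (fun x => a x * b x) := by
    intro a b ha hb h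
    refine (ha.mul hb).integrable_of_hasCompactSupport ?_
    exact h.elim (fun h => h.mul_right) (fun h => h.mul_left)
  refine integral_mul_fderiv_eq_neg_fderiv_mul_of_integrable
    (key (contDiff_dirDeriv hf v).continuous hg.continuous ?_)
    (key hf.continuous (contDiff_dirDeriv hg v).continuous ?_)
    (key hf.continuous hg.continuous hc)
    (fun x _ => hf.differentiable (by simp) x) (fun x _ => hg.differentiable (by simp) x)
  · exact hc.imp_left fun h => hasCompactSupport_dirDeriv h v
  · exact hc.imp_right fun h => hasCompactSupport_dirDeriv h v

/-- Green's second identity without boundary terms. -/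
lemma integral_mul_laplacian {w φ : 𝔼 → ℝ} (hw : ContDiff ℝ (⊤ : ℕ∞) w)
    (hφ : ContDiff ℝ (⊤ : ℕ∞) φ) (hc : HasCompactSupport φ) :
    ∫ x, w x * laplacian φ x = ∫ x, laplacian w x * φ x := by
  simp only [laplacian_eq_sum_dirDeriv hφ, laplacian_eq_sum_dirDeriv hw, Finset.mul_sum,
    Finset.sum_mul]
  rw [integral_finsetSum, integral_finsetSum]
  · refine Finset.sum_congr rfl fun i _ => ?_
    rw [integral_mul_dirDeriv hw (contDiff_dirDeriv hφ _)
      (Or.inr (hasCompactSupport_dirDeriv hc _)),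
      integral_mul_dirDeriv (contDiff_dirDeriv hw _) hφ (Or.inr hc), neg_neg]
  · intro i _
    exact ((contDiff_dirDeriv (contDiff_dirDeriv hw _) _).continuous.mul
      hφ.continuous).integrable_of_hasCompactSupport hc.mul_left
  · intro i _
    exact (hw.continuous.mul (contDiff_dirDeriv (contDiff_dirDeriv hφ _) _).continuous
      ).integrable_of_hasCompactSupport
      (hasCompactSupport_dirDeriv (hasCompactSupport_dirDeriv hc _) _).mul_left

end Smooth

section Barrier

lemma second_deriv_nonpos_of_isLocalMax {g g₁ : ℝ → ℝ} {a t₀ : ℝ}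
    (h₁ : ∀ᶠ t in nhds t₀, HasDerivAt g (g₁ t) t) (h₂ : HasDerivAt g₁ a t₀)
    (hmax : IsLocalMax g t₀) : a ≤ 0 := by
  by_contra! ha
  have he : deriv g =ᶠ[nhds t₀] g₁ := h₁.mono fun t ht => ht.deriv
  have hdd : deriv (deriv g) t₀ = a := by rw [he.deriv_eq, h₂.deriv]
  have hmin : IsLocalMin g t₀ := isLocalMin_of_deriv_deriv_pos (by rw [hdd]; exact ha)
    hmax.deriv_eq_zero h₁.self_of_nhds.continuousAt
  have hconst : g =ᶠ[nhds t₀] fun _ => g t₀ := by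
    filter_upwards [hmax, hmin] with t h h' using le_antisymm h h'
  have h0 : deriv (deriv g) t₀ = 0 := by
    rw [hconst.deriv.deriv_eq]
    simp
  linarith

lemma hasDerivAt_inv_pow {s : ℝ → ℝ} {s' t : ℝ} (hs : HasDerivAt s s' t) (h0 : s t ≠ 0) (m : ℕ) :
    HasDerivAt (fun t => (s t)⁻¹ ^ m) (-(m * (s t)⁻¹ ^ (m + 1) * s')) t := by
  refine ((hs.fun_inv h0).fun_pow m).congr_deriv ?_
  rcases m with _ | m
  · simp
  · simp only [Nat.add_sub_cancel, inv_pow]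
    field_simp
    ring

variable {N : ℕ}

local notation "𝔼" => EuclideanSpace ℝ (Fin N)

lemma norm_line_sq (y : 𝔼) (i : Fin N) (t : ℝ) :
    ‖y + t • EuclideanSpace.single i (1 : ℝ)‖ ^ 2 = ‖y‖ ^ 2 + 2 * t * y i + t ^ 2 := by
  rw [norm_add_sq_real]
  simp [real_inner_smul_right, norm_smul, EuclideanSpace.inner_single_right]
  ring

/-- Upper bound for the Laplacian of a smooth function touched from above by the Keller–Osserman
barrier `C (R² - |x - x₀|²)⁻ᵐ` up to a constant. -/
lemma laplacian_le_of_isLocalMax_sub_barrier {w : 𝔼 → ℝ} (hw : ContDiff ℝ (⊤ : ℕ∞) w)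
    {x₀ x : 𝔼} {R C : ℝ} {m : ℕ} (hx : 0 < R ^ 2 - ‖x - x₀‖ ^ 2)
    (hmax : IsLocalMax (fun y => w y - C * (R ^ 2 - ‖y - x₀‖ ^ 2)⁻¹ ^ m) x) :
    laplacian w x ≤ C * (4 * m * (m + 1) * ‖x - x₀‖ ^ 2 * (R ^ 2 - ‖x - x₀‖ ^ 2)⁻¹ ^ (m + 2)
      + 2 * m * N * (R ^ 2 - ‖x - x₀‖ ^ 2)⁻¹ ^ (m + 1)) := by
  set σ := (R ^ 2 - ‖x - x₀‖ ^ 2)⁻¹ with hσ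
  have key : ∀ i : Fin N, dirDeriv (EuclideanSpace.single i 1)
      (dirDeriv (EuclideanSpace.single i 1) w) x ≤
      C * (4 * m * (m + 1) * ((x - x₀) i) ^ 2 * σ ^ (m + 2) + 2 * m * σ ^ (m + 1)) := by
    intro i
    set e : 𝔼 := EuclideanSpace.single i 1 with he
    set b := (x - x₀) i with hb
    set s : ℝ → ℝ := fun t => R ^ 2 - ‖x - x₀‖ ^ 2 - 2 * t * b - t ^ 2 with hs
    have hs0 : s 0 = R ^ 2 - ‖x - x₀‖ ^ 2 := by simp [hs]
    have hsline : ∀ t, R ^ 2 - ‖x + t • e - x₀‖ ^ 2 = s t := by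
      intro t
      rw [add_sub_right_comm, he, norm_line_sq]
      simp only [hs, hb]
      ring
    have hsd : ∀ t, HasDerivAt s (-(2 * b + 2 * t)) t := by
      intro t
      have h1 : HasDerivAt (fun t : ℝ => 2 * t * b) (2 * b) t := by
        simpa using ((hasDerivAt_id t).const_mul 2).mul_const b
      have h2 : HasDerivAt (fun t : ℝ => t ^ 2) (2 * t) t := by
        simpa using hasDerivAt_pow 2 t
      refine (((hasDerivAt_const t (R ^ 2 - ‖x - x₀‖ ^ 2)).sub h1).sub h2).congr_deriv ?_
      ring
    have hpos : ∀ᶠ t in nhds (0 : ℝ), s t ≠ 0 := by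
      have : ContinuousAt s 0 := (hsd 0).continuousAt
      exact this.eventually_ne (by rw [hs0]; exact hx.ne')
    have hline : IsLocalMax (fun t : ℝ => w (x + t • e) - C * (s t)⁻¹ ^ m) 0 := by
      have hc : ContinuousAt (fun t : ℝ => x + t • e) 0 := by fun_prop
      have ht : Tendsto (fun t : ℝ => x + t • e) (nhds 0) (nhds x) := by
        simpa [ContinuousAt] using hc
      have := ht.eventually hmax
      simp only [hsline] at this
      filter_upwards [this] with t ht
      simpa [hs0] using ht
    have h2 := second_deriv_nonpos_of_isLocalMax
      (g₁ := fun t => dirDeriv e w (x + t • e)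
        - C * (m * (s t)⁻¹ ^ (m + 1) * (2 * b + 2 * t)))
      (a := dirDeriv e (dirDeriv e w) x
        - C * (m * ((m + 1) * σ ^ (m + 2) * (2 * b) * (2 * b) + σ ^ (m + 1) * 2)))
      ?_ ?_ hline
    · refine (sub_nonpos.1 h2).trans_eq ?_
      ring
    · filter_upwards [hpos] with t ht
      refine (hasDerivAt_line hw x e t).sub (((hasDerivAt_inv_pow (hsd t) ht m).const_mul C
        ).congr_deriv ?_)
      ring
    · have h3 : HasDerivAt (fun t : ℝ => dirDeriv e w (x + t • e))
          (dirDeriv e (dirDeriv e w) x) 0 := by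
        simpa using hasDerivAt_line (contDiff_dirDeriv hw e) x e 0
      refine h3.sub ?_
      have h4 : HasDerivAt (fun t : ℝ => 2 * b + 2 * t) 2 0 := by
        simpa using ((hasDerivAt_id (0 : ℝ)).const_mul 2).const_add (2 * b)
      have h5 := hasDerivAt_inv_pow (hsd 0) hpos.self_of_nhds (m + 1)
      refine ((((h5.const_mul (m : ℝ)).mul h4).const_mul C).congr_deriv ?_).congr_of_eventuallyEq
        (Eventually.of_forall fun t => ?_)
      · rw [hs0, ← hσ]
        push_cast
        ring
      · simp only [Pi.mul_apply]
  calc laplacian w x ≤ ∑ i : Fin N, C * (4 * m * (m + 1) * ((x - x₀) i) ^ 2 * σ ^ (m + 2)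
        + 2 * m * σ ^ (m + 1)) := by
        rw [laplacian_eq_sum_dirDeriv hw]
        exact Finset.sum_le_sum fun i _ => key i
    _ = _ := by
        rw [EuclideanSpace.real_norm_sq_eq, ← Finset.mul_sum, Finset.sum_add_distrib,
          ← Finset.sum_mul, ← Finset.mul_sum]
        simp only [Finset.sum_const, Finset.card_univ, Fintype.card_fin, nsmul_eq_mul]
        ring

lemma exists_barrier_constants (N : ℕ) {q : ℝ} (hq : 1 < q) :
    ∃ (C : ℝ) (m : ℕ), 0 < C ∧ m ≠ 0 ∧ ∀ r σ : ℝ, 0 ≤ r → r ≤ 1 → 1 ≤ σ →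
      C * (4 * m * (m + 1) * r * σ ^ (m + 2) + 2 * m * N * σ ^ (m + 1)) ≤ (C * σ ^ m) ^ q := by
  obtain ⟨m, hm⟩ := exists_nat_ge (2 / (q - 1))
  have hq' : 0 < q - 1 := by linarith
  have hm0 : m ≠ 0 := by
    rintro rfl
    have : 0 < 2 / (q - 1) := by positivity
    simp only [Nat.cast_zero] at hm
    linarith
  set A : ℝ := 4 * m * (m + 1) + 2 * m * N + 1 with hA
  have hA1 : 1 ≤ A := by rw [hA]; linarith [show (0 : ℝ) ≤ 4 * m * (m + 1) + 2 * m * N by positivity]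
  have hA0 : 0 < A := by linarith
  have hC0 : 0 < A ^ (1 / (q - 1)) := Real.rpow_pos_of_pos hA0 _
  refine ⟨A ^ (1 / (q - 1)), m, hC0, hm0, fun r σ hr hr1 hσ => ?_⟩
  have hσ0 : 0 < σ := by linarith
  set C := A ^ (1 / (q - 1)) with hC
  have hCq : C ^ q = C * A := by
    have h1 : C ^ (q - 1) = A := by
      rw [hC, ← Real.rpow_mul hA0.le, one_div, inv_mul_cancel₀ hq'.ne', Real.rpow_one]
    rw [show q = 1 + (q - 1) by ring, Real.rpow_add hC0, Real.rpow_one, h1]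
  have hσm : σ ^ (m + 2) ≤ (σ ^ m) ^ q := by
    rw [← Real.rpow_natCast σ m, ← Real.rpow_mul hσ0.le, ← Real.rpow_natCast σ (m + 2)]
    apply Real.rpow_le_rpow_of_exponent_le hσ
    rw [div_le_iff₀ hq'] at hm
    push_cast
    linarith
  have hσ12 : σ ^ (m + 1) ≤ σ ^ (m + 2) := pow_le_pow_right₀ hσ (by omega)
  rw [Real.mul_rpow hC0.le (by positivity), hCq, mul_assoc C A]
  refine mul_le_mul_of_nonneg_left ?_ hC0.le
  calc 4 * m * (m + 1) * r * σ ^ (m + 2) + 2 * m * N * σ ^ (m + 1)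
      ≤ 4 * m * (m + 1) * 1 * σ ^ (m + 2) + 2 * m * N * σ ^ (m + 2) := by gcongr
    _ ≤ A * σ ^ (m + 2) := by
        rw [hA]
        linarith [show 0 < σ ^ (m + 2) by positivity]
    _ ≤ A * (σ ^ m) ^ q := by gcongr

/-- `u` is, on `K`, a uniform limit of smooth functions that are almost classical subsolutions of
`-Δu + u ^ q = 0`. -/
def SmoothApprox (q : ℝ) (K : Set 𝔼) (u : 𝔼 → ℝ) : Prop :=
  ∀ η : ℝ, 0 < η → ∃ w : 𝔼 → ℝ, ContDiff ℝ (⊤ : ℕ∞) w ∧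
    ∀ x ∈ K, |w x - u x| ≤ η ∧ (max (u x - η) 0) ^ q ≤ laplacian w x

/-- The Keller–Osserman bound. -/
lemma SmoothApprox.le_barrier {q R C : ℝ} {m : ℕ} (hq : 1 < q) (hC : 0 < C)
    (hbar : ∀ r σ : ℝ, 0 ≤ r → r ≤ 1 → 1 ≤ σ →
      C * (4 * m * (m + 1) * r * σ ^ (m + 2) + 2 * m * N * σ ^ (m + 1)) ≤ (C * σ ^ m) ^ q)
    (hm : m ≠ 0) (hR : 0 < R) (hR1 : R ≤ 1) {x₀ : 𝔼} {u : 𝔼 → ℝ}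
    (hu : SmoothApprox q (Metric.closedBall x₀ R) u) {x : 𝔼} (hx : x ∈ Metric.ball x₀ R) :
    u x ≤ C * (R ^ 2 - ‖x - x₀‖ ^ 2)⁻¹ ^ m := by
  have hs : ∀ y ∈ Metric.ball x₀ R, 0 < R ^ 2 - ‖y - x₀‖ ^ 2 := by
    intro y hy
    rw [mem_ball_iff_norm] at hy
    nlinarith [norm_nonneg (y - x₀)]
  refine le_of_forall_pos_le_add fun ε hε => ?_
  obtain ⟨w, hw, hwu⟩ := hu (ε / 3) (by positivity)
  set W : 𝔼 → ℝ := fun y => C * (R ^ 2 - ‖y - x₀‖ ^ 2)⁻¹ ^ m with hW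
  have hWc : ContinuousOn W (Metric.ball x₀ R) := by
    refine continuousOn_const.mul (ContinuousOn.pow (ContinuousOn.inv₀ (by fun_prop) ?_) m)
    exact fun y hy => (hs y hy).ne'
  suffices hle : w x ≤ W x + 2 * (ε / 3) by
    have := (abs_le.1 (hwu x (Metric.ball_subset_closedBall hx)).1).1
    linarith
  by_contra! hlt
  obtain ⟨B, hB⟩ := (isCompact_closedBall x₀ R).bddAbove_image hw.continuous.continuousOn
  have hB' : ∀ y ∈ Metric.closedBall x₀ R, w y ≤ B := fun y hy => hB (mem_image_of_mem _ hy)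
  have hWB : ∃ δ, 0 < δ ∧ ∀ y ∈ Metric.ball x₀ R, R ^ 2 - ‖y - x₀‖ ^ 2 < δ → B ≤ W y := by
    have ht : Tendsto (fun s : ℝ => C * s⁻¹ ^ m) (nhdsWithin 0 (Ioi 0)) atTop :=
      ((tendsto_pow_atTop hm).comp tendsto_inv_nhdsGT_zero).const_mul_atTop hC
    obtain ⟨δ, hδ, h⟩ := mem_nhdsGT_iff_exists_Ioo_subset.1 (ht.eventually_ge_atTop B)
    exact ⟨δ, hδ, fun y hy hyδ => h ⟨hs y hy, hyδ⟩⟩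
  obtain ⟨δ, hδ, hδW⟩ := hWB
  set K : Set 𝔼 := Metric.closedBall x₀ R ∩ {y | δ ≤ R ^ 2 - ‖y - x₀‖ ^ 2} with hK
  have hKb : K ⊆ Metric.ball x₀ R := by
    rintro y ⟨-, hy⟩
    rw [mem_ball_iff_norm]
    have : δ ≤ R ^ 2 - ‖y - x₀‖ ^ 2 := hy
    nlinarith [norm_nonneg (y - x₀)]
  have hKc : IsCompact K := (isCompact_closedBall x₀ R).inter_right
    (isClosed_le continuous_const (by fun_prop))
  have hout : ∀ y ∈ Metric.ball x₀ R, y ∉ K → w y - W y ≤ 0 := by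
    intro y hy hyK
    have h1 := hB' y (Metric.ball_subset_closedBall hy)
    have h2 := hδW y hy (by
      by_contra! h
      exact hyK ⟨Metric.ball_subset_closedBall hy, h⟩)
    linarith
  have hxK : x ∈ K := by
    by_contra h
    linarith [hout x hx h]
  obtain ⟨z, hzK, hz⟩ := hKc.exists_isMaxOn ⟨x, hxK⟩
    (hw.continuous.continuousOn.sub (hWc.mono hKb))
  have hzx : w x - W x ≤ w z - W z := hz hxK
  have hzb := hKb hzK
  have hmax : IsLocalMax (fun y => w y - W y) z := by
    filter_upwards [Metric.isOpen_ball.mem_nhds hzb] with y hy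
    by_cases hyK : y ∈ K
    · exact hz hyK
    · linarith [hout y hy hyK]
  have hσ : 1 ≤ (R ^ 2 - ‖z - x₀‖ ^ 2)⁻¹ := by
    rw [one_le_inv₀ (hs z hzb)]
    nlinarith [sq_nonneg ‖z - x₀‖]
  have h1 := laplacian_le_of_isLocalMax_sub_barrier hw (hs z hzb) hmax
  have h2 := hbar (‖z - x₀‖ ^ 2) _ (sq_nonneg _) (by nlinarith [hs z hzb]) hσ
  obtain ⟨h3, h4⟩ := hwu z (Metric.ball_subset_closedBall hzb)
  have hWz : 0 < W z := by
    have := hs z hzb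
    positivity
  have h5 : W z < max (u z - ε / 3) 0 :=
    lt_max_of_lt_left (by linarith [(abs_le.1 h3).2])
  have h6 : W z ^ q < (max (u z - ε / 3) 0) ^ q :=
    Real.rpow_lt_rpow hWz.le h5 (by linarith)
  have h7 : laplacian w z ≤ W z ^ q := h1.trans h2
  linarith

end Barrier

section Sup

variable {N : ℕ}

local notation "𝔼" => EuclideanSpace ℝ (Fin N)

lemma dirDeriv_smoothMax {f g : 𝔼 → ℝ} (hf : ContDiff ℝ (⊤ : ℕ∞) f) (hg : ContDiff ℝ (⊤ : ℕ∞) g)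
    {δ : ℝ} (hδ : 0 < δ)
    (hw : ContDiff ℝ (⊤ : ℕ∞) fun x => (f x + g x) / 2 + √((f x - g x) ^ 2 + δ ^ 2) / 2)
    (v x : 𝔼) :
    (1 + (f x - g x) / √((f x - g x) ^ 2 + δ ^ 2)) / 2 * dirDeriv v (dirDeriv v f) x
      + (1 - (f x - g x) / √((f x - g x) ^ 2 + δ ^ 2)) / 2 * dirDeriv v (dirDeriv v g) x
      ≤ dirDeriv v (dirDeriv v
        fun x => (f x + g x) / 2 + √((f x - g x) ^ 2 + δ ^ 2) / 2) x := by
  set S : 𝔼 → ℝ := fun x => √((f x - g x) ^ 2 + δ ^ 2) with hS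
  have hSpos : ∀ y, 0 < S y := fun y => Real.sqrt_pos.2 (by positivity)
  have hSsq : ∀ y, S y ^ 2 = (f y - g y) ^ 2 + δ ^ 2 := fun y => Real.sq_sqrt (by positivity)
  have hline : ∀ {k : 𝔼 → ℝ}, ContDiff ℝ (⊤ : ℕ∞) k → ∀ y,
      HasDerivAt (fun t : ℝ => k (y + t • v)) (dirDeriv v k y) 0 := by
    intro k hk y
    simpa using hasDerivAt_line hk y v 0
  have hSd : ∀ y, HasDerivAt (fun t : ℝ => S (y + t • v))
      ((f y - g y) * (dirDeriv v f y - dirDeriv v g y) / S y) 0 := by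
    intro y
    have h1 := ((((hline hf y).sub (hline hg y)).fun_pow 2).add_const (δ ^ 2)).sqrt (by
      simp only [zero_smul, add_zero, Pi.sub_apply]; positivity)
    refine (h1.congr_deriv ?_)
    simp only [zero_smul, add_zero, Pi.sub_apply, hS]
    field_simp
    simp only [Nat.cast_ofNat, Nat.add_one_sub_one, pow_one]
    ring
  have hd1 : dirDeriv v (fun x => (f x + g x) / 2 + S x / 2) = fun y =>
      (dirDeriv v f y + dirDeriv v g y) / 2
        + (f y - g y) * (dirDeriv v f y - dirDeriv v g y) / S y / 2 := by
    funext y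
    exact dirDeriv_eq_of_hasDerivAt hw
      ((((hline hf y).add (hline hg y)).div_const 2).add ((hSd y).div_const 2))
  have hw1 := contDiff_dirDeriv hw v
  have hf1 := contDiff_dirDeriv hf v
  have hg1 := contDiff_dirDeriv hg v
  rw [hd1] at hw1
  have hd2 : dirDeriv v (dirDeriv v fun x => (f x + g x) / 2 + S x / 2) x =
      (dirDeriv v (dirDeriv v f) x + dirDeriv v (dirDeriv v g) x) / 2
      + ((((dirDeriv v f x - dirDeriv v g x) * (dirDeriv v f x - dirDeriv v g x)
          + (f x - g x) * (dirDeriv v (dirDeriv v f) x - dirDeriv v (dirDeriv v g) x)) * S x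
        - (f x - g x) * (dirDeriv v f x - dirDeriv v g x)
          * ((f x - g x) * (dirDeriv v f x - dirDeriv v g x) / S x)) / S x ^ 2) / 2 := by
    rw [hd1]
    refine dirDeriv_eq_of_hasDerivAt hw1 ?_
    have h1 := (((hline hf x).sub (hline hg x)).mul ((hline hf1 x).sub (hline hg1 x))).div (hSd x)
      (by simpa using (hSpos x).ne')
    have h2 := (((hline hf1 x).add (hline hg1 x)).div_const 2).add (h1.div_const 2)
    exact h2.congr_deriv (by simp)
  rw [hd2]
  have hSx := hSpos x
  have hsq := hSsq x
  change (1 + (f x - g x) / S x) / 2 * _ + (1 - (f x - g x) / S x) / 2 * _ ≤ _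
  generalize S x = s at *
  generalize dirDeriv v (dirDeriv v f) x = F
  generalize dirDeriv v (dirDeriv v g) x = G
  generalize dirDeriv v f x - dirDeriv v g x = d
  generalize f x - g x = h at *
  have : (F + G) / 2 + (((d * d + h * (F - G)) * s - h * d * (h * d / s)) / s ^ 2) / 2
      - ((1 + h / s) / 2 * F + (1 - h / s) / 2 * G) = d ^ 2 * (s ^ 2 - h ^ 2) / (2 * s ^ 3) := by
    field_simp
    ring
  rw [← sub_nonneg, this, hsq, add_sub_cancel_left]
  positivity

lemma contDiff_smoothMax {f g : 𝔼 → ℝ} (hf : ContDiff ℝ (⊤ : ℕ∞) f)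
    (hg : ContDiff ℝ (⊤ : ℕ∞) g) {δ : ℝ} (hδ : 0 < δ) :
    ContDiff ℝ (⊤ : ℕ∞) fun x => (f x + g x) / 2 + √((f x - g x) ^ 2 + δ ^ 2) / 2 := by
  refine ((hf.add hg).div_const 2).add (ContDiff.div_const ?_ 2)
  exact (((hf.sub hg).pow 2).add contDiff_const).sqrt fun x => by positivity

lemma laplacian_smoothMax {f g : 𝔼 → ℝ} (hf : ContDiff ℝ (⊤ : ℕ∞) f)
    (hg : ContDiff ℝ (⊤ : ℕ∞) g) {δ : ℝ} (hδ : 0 < δ) (x : 𝔼) :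
    (1 + (f x - g x) / √((f x - g x) ^ 2 + δ ^ 2)) / 2 * laplacian f x
      + (1 - (f x - g x) / √((f x - g x) ^ 2 + δ ^ 2)) / 2 * laplacian g x
      ≤ laplacian (fun x => (f x + g x) / 2 + √((f x - g x) ^ 2 + δ ^ 2) / 2) x := by
  have hw := contDiff_smoothMax hf hg hδ
  rw [laplacian_eq_sum_dirDeriv hf, laplacian_eq_sum_dirDeriv hg, laplacian_eq_sum_dirDeriv hw,
    Finset.mul_sum, Finset.mul_sum, ← Finset.sum_add_distrib]
  exact Finset.sum_le_sum fun i _ => dirDeriv_smoothMax hf hg hδ hw _ x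

lemma SmoothApprox.sup {q : ℝ} (hq : 1 ≤ q) {K : Set 𝔼} {u v : 𝔼 → ℝ}
    (hu0 : ∀ x ∈ K, 0 ≤ u x) (hv0 : ∀ x ∈ K, 0 ≤ v x)
    (hu : SmoothApprox q K u) (hv : SmoothApprox q K v) :
    SmoothApprox q K (fun x => max (u x) (v x)) := by
  intro η hη
  set δ := η / 10 with hδ
  have hδ0 : 0 < δ := by positivity
  obtain ⟨f, hf, hfu⟩ := hu δ hδ0
  obtain ⟨g, hg, hgv⟩ := hv δ hδ0
  refine ⟨_, contDiff_smoothMax hf hg hδ0, fun x hx => ?_⟩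
  obtain ⟨hf1, hf2⟩ := hfu x hx
  obtain ⟨hg1, hg2⟩ := hgv x hx
  have hu0 := hu0 x hx
  have hv0 := hv0 x hx
  have hL := laplacian_smoothMax hf hg hδ0 x
  have hS0 : 0 < √((f x - g x) ^ 2 + δ ^ 2) := Real.sqrt_pos.2 (by positivity)
  have hSsq : √((f x - g x) ^ 2 + δ ^ 2) ^ 2 = (f x - g x) ^ 2 + δ ^ 2 :=
    Real.sq_sqrt (by positivity)
  set S := √((f x - g x) ^ 2 + δ ^ 2) with hS
  rw [abs_le] at hf1 hg1
  have hhS : |f x - g x| ≤ S := abs_le_of_sq_le_sq (by nlinarith) hS0.le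
  have hSh : S ≤ |f x - g x| + δ := by
    refine abs_le_of_sq_le_sq' ?_ (by positivity) |>.2
    rw [hSsq]
    nlinarith [sq_abs (f x - g x), abs_nonneg (f x - g x)]
  constructor
  · beta_reduce
    rw [abs_le]
    rcases max_cases (u x) (v x) with ⟨h1, h2⟩ | ⟨h1, h2⟩ <;> rw [h1] <;>
    rcases abs_cases (f x - g x) with ⟨h3, h4⟩ | ⟨h3, h4⟩ <;> rw [h3] at hSh hhS <;>
    constructor <;> linarith
  · refine le_trans ?_ hL
    set s := (f x - g x) / S with hs
    have hs1 : |s| ≤ 1 := by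
      rw [hs, abs_div, abs_of_pos hS0]
      exact div_le_one_of_le₀ hhS hS0.le
    have hsh : |f x - g x| - δ ≤ s * (f x - g x) := by
      have : s * (f x - g x) = (S ^ 2 - δ ^ 2) / S := by
        rw [hSsq, hs]; ring
      have hδS : δ ≤ S := Real.le_sqrt_of_sq_le (by nlinarith [sq_nonneg (f x - g x)])
      rw [this, le_div_iff₀ hS0]
      nlinarith
    obtain ⟨hs2, hs3⟩ := abs_le.1 hs1
    set a := max (u x - δ) 0 with ha
    set b := max (v x - δ) 0 with hb
    have ha0 : 0 ≤ a := le_max_right _ _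
    have hb0 : 0 ≤ b := le_max_right _ _
    have ha1 : u x - δ ≤ a := le_max_left _ _
    have hb1 : v x - δ ≤ b := le_max_left _ _
    have ha2 : a ≤ u x := max_le (by linarith) hu0
    have hb2 : b ≤ v x := max_le (by linarith) hv0
    have hJ := (convexOn_rpow hq).2 (mem_Ici.2 ha0) (mem_Ici.2 hb0)
      (show 0 ≤ (1 + s) / 2 by linarith) (show 0 ≤ (1 - s) / 2 by linarith) (by ring)
    simp only [smul_eq_mul] at hJ
    have hle : (1 + s) / 2 * a ^ q + (1 - s) / 2 * b ^ q ≤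
        (1 + s) / 2 * laplacian f x + (1 - s) / 2 * laplacian g x := by
      gcongr; all_goals linarith
    refine le_trans ?_ (hJ.trans hle)
    refine Real.rpow_le_rpow (le_max_right _ _) (max_le ?_ ?_) (by linarith)
    · have hd : |(a - b) - (f x - g x)| ≤ 3 * δ := by
        rw [abs_le]; constructor <;> linarith
      have h1 : s * (f x - g x) - 3 * δ ≤ s * (a - b) := by
        have : |s * ((a - b) - (f x - g x))| ≤ 1 * (3 * δ) := by
          rw [abs_mul]; gcongr
        linarith [(abs_le.1 this).1, mul_sub s (a - b) (f x - g x)]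
      have h2 : |a - b| - 3 * δ ≤ |f x - g x| := by
        have := abs_sub_abs_le_abs_sub (a - b) (f x - g x)
        linarith
      have h3 : |a - b| - 7 * δ ≤ s * (a - b) := by linarith
      have h4 : (1 + s) / 2 * a + (1 - s) / 2 * b = (a + b) / 2 + s * (a - b) / 2 := by ring
      rw [h4]
      beta_reduce
      rcases max_cases (u x) (v x) with ⟨h5, h6⟩ | ⟨h5, h6⟩ <;> rw [h5]
      · linarith [le_abs_self (a - b)]
      · linarith [neg_abs_le (a - b)]
    · exact add_nonneg (mul_nonneg (by linarith) ha0) (mul_nonneg (by linarith) hb0)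

end Sup

section Mollification

variable {N : ℕ}

local notation "𝔼" => EuclideanSpace ℝ (Fin N)

open scoped Convolution in
lemma dirDeriv_convolution {g ρ : 𝔼 → ℝ} (hg : LocallyIntegrable g)
    (hρ : ContDiff ℝ (⊤ : ℕ∞) ρ) (hc : HasCompactSupport ρ) (v : 𝔼) :
    dirDeriv v (g ⋆[ContinuousLinearMap.lsmul ℝ ℝ, volume] ρ) =
      g ⋆[ContinuousLinearMap.lsmul ℝ ℝ, volume] (dirDeriv v ρ) := by
  funext x
  have h := hc.hasFDerivAt_convolution_right (ContinuousLinearMap.lsmul ℝ ℝ) hg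
    (hρ.of_le (by norm_cast)) x
  rw [dirDeriv, h.fderiv, convolution_precompR_apply _ hg (hc.fderiv ℝ)
    (hρ.continuous_fderiv (by simp))]
  rfl

open scoped Convolution in
lemma laplacian_convolution {g ρ : 𝔼 → ℝ} (hg : LocallyIntegrable g)
    (hρ : ContDiff ℝ (⊤ : ℕ∞) ρ) (hc : HasCompactSupport ρ) (x : 𝔼) :
    laplacian (g ⋆[ContinuousLinearMap.lsmul ℝ ℝ, volume] ρ) x =
      ∫ t, g t * laplacian ρ (x - t) := by
  rw [laplacian_eq_sum_dirDeriv (hc.contDiff_convolution_right _ hg hρ)]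
  simp only [laplacian_eq_sum_dirDeriv hρ, Finset.mul_sum]
  rw [integral_finsetSum]
  · refine Finset.sum_congr rfl fun i _ => ?_
    rw [dirDeriv_convolution hg hρ hc, dirDeriv_convolution hg (contDiff_dirDeriv hρ _)
      (hasCompactSupport_dirDeriv hc _)]
    rfl
  · intro i _
    exact (hasCompactSupport_dirDeriv (hasCompactSupport_dirDeriv hc _) _).convolutionExists_right
      (ContinuousLinearMap.lsmul ℝ ℝ) hg
      (contDiff_dirDeriv (contDiff_dirDeriv hρ _) _).continuous x

lemma dirDeriv_comp_const_sub {ρ : 𝔼 → ℝ} (hρ : ContDiff ℝ (⊤ : ℕ∞) ρ) (x v : 𝔼) :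
    dirDeriv v (fun t => ρ (x - t)) = fun t => -dirDeriv v ρ (x - t) := by
  funext t
  have h := ((hρ.differentiable (by simp) (x - t)).hasFDerivAt.comp t
    ((hasFDerivAt_id t).const_sub x)).fderiv
  simp only [Function.comp_def] at h
  simp [dirDeriv, h]

lemma laplacian_comp_const_sub {ρ : 𝔼 → ℝ} (hρ : ContDiff ℝ (⊤ : ℕ∞) ρ) (x t : 𝔼) :
    laplacian (fun t => ρ (x - t)) t = laplacian ρ (x - t) := by
  have hφ : ContDiff ℝ (⊤ : ℕ∞) (fun t => ρ (x - t)) :=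
    hρ.comp (contDiff_const.sub contDiff_id)
  rw [laplacian_eq_sum_dirDeriv hφ, laplacian_eq_sum_dirDeriv hρ]
  refine Finset.sum_congr rfl fun i _ => ?_
  have h1 := dirDeriv_comp_const_sub (contDiff_dirDeriv hρ (EuclideanSpace.single i 1)) x
    (EuclideanSpace.single i 1)
  have h2 : ∀ f : 𝔼 → ℝ, dirDeriv (EuclideanSpace.single i 1) (fun t => -f t) t =
      -dirDeriv (EuclideanSpace.single i 1) f t := by
    intro f
    simp [dirDeriv, fderiv_fun_neg]
  rw [dirDeriv_comp_const_sub hρ, h2, h1, neg_neg]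

lemma abs_rpow_sub_one_mul_self {q a : ℝ} (hq : 1 < q) (ha : 0 ≤ a) :
    |a| ^ (q - 1) * a = a ^ q := by
  rw [abs_of_nonneg ha]
  rcases ha.eq_or_lt with rfl | ha
  · rw [mul_zero, Real.zero_rpow (by linarith)]
  · rw [Real.rpow_sub_one ha.ne']
    field_simp

/-- For continuous nonnegative `u` the integrand of the weak inequality may be restricted to any
compact subset of `Ω` containing the support of the test function. -/
lemma setIntegral_weak_eq {q : ℝ} (hq : 1 < q) {Ω K : Set 𝔼} {u φ : 𝔼 → ℝ}
    (hpos : ∀ x ∈ Ω, 0 ≤ u x) (hφ : ContDiff ℝ (⊤ : ℕ∞) φ) (hφK : tsupport φ ⊆ K) (hKΩ : K ⊆ Ω)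
    (hΩ : MeasurableSet Ω) (hK : MeasurableSet K) :
    ∫ x in Ω, (-(u x) * laplacian φ x + |u x| ^ (q - 1) * u x * φ x) =
      ∫ x in K, (-(u x) * laplacian φ x + u x ^ q * φ x) := by
  rw [setIntegral_eq_of_subset_of_forall_sdiff_eq_zero hΩ hKΩ]
  · refine setIntegral_congr_fun hK fun x hx => ?_
    rw [abs_rpow_sub_one_mul_self hq (hpos x (hKΩ hx))]
  · intro x hx
    have hx' : x ∉ tsupport φ := fun h => hx.2 (hφK h)
    rw [laplacian_eq_zero_of_notMem_tsupport hφ hx', image_eq_zero_of_notMem_tsupport hx']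
    simp

open scoped Convolution in
lemma IsSubsolution.smoothApprox {q : ℝ} (hq : 1 < q) {Ω K : Set 𝔼} (hΩ : IsOpen Ω)
    (hK : IsCompact K) (hKΩ : K ⊆ Ω) {u : 𝔼 → ℝ} (hcont : ContinuousOn u Ω)
    (hpos : ∀ x ∈ Ω, 0 ≤ u x) (hu : IsSubsolution q Ω u) : SmoothApprox q K u := by
  intro η hη
  obtain ⟨r, hr, hrΩ⟩ := hK.exists_cthickening_subset_open hΩ hKΩ
  set K' := Metric.cthickening r K with hK'
  have hK'c : IsCompact K' := hK.cthickening
  have hcont' := hcont.mono hrΩ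
  obtain ⟨δ, hδ, hδu⟩ := Metric.uniformContinuousOn_iff.1
    (hK'c.uniformContinuousOn_of_continuous hcont') η hη
  set ε := min δ r with hε
  have hε0 : 0 < ε := lt_min hδ hr
  have hball : ∀ x ∈ K, Metric.closedBall x ε ⊆ K' := fun x hx =>
    (Metric.closedBall_subset_closedBall (min_le_right _ _)).trans
      (Metric.closedBall_subset_cthickening hx r)
  have hosc : ∀ x ∈ K, ∀ y ∈ Metric.ball x ε, dist (u y) (u x) ≤ η := by
    intro x hx y hy
    refine (hδu y (hball x hx (Metric.ball_subset_closedBall hy)) x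
      (Metric.self_subset_cthickening K hx) ?_).le
    exact (Metric.mem_ball.1 hy).trans_le (min_le_left _ _)
  let b : ContDiffBump (0 : 𝔼) := ⟨ε / 2, ε, by positivity, by linarith⟩
  set ρ : 𝔼 → ℝ := b.normed volume with hρdef
  have hρ : ContDiff ℝ (⊤ : ℕ∞) ρ := b.contDiff_normed
  have hρc : HasCompactSupport ρ := b.hasCompactSupport_normed
  set g : 𝔼 → ℝ := K'.indicator u with hg
  have hgi : Integrable g :=
    (integrable_indicator_iff hK'c.measurableSet).2 (hcont'.integrableOn_compact hK'c)
  have hgK' : ∀ y ∈ K', g y = u y := fun y hy => indicator_of_mem hy u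
  refine ⟨g ⋆[ContinuousLinearMap.lsmul ℝ ℝ, volume] ρ,
    hρc.contDiff_convolution_right _ hgi.locallyIntegrable hρ, fun x hx => ⟨?_, ?_⟩⟩
  · have hxK' : x ∈ K' := hball x hx (Metric.mem_closedBall_self hε0.le)
    have h := b.dist_normed_convolution_le (μ := volume) (g := g) (x₀ := x) (ε := η)
      hgi.aestronglyMeasurable (by
        intro y hy
        rw [hgK' x hxK', hgK' y (hball x hx (Metric.ball_subset_closedBall hy))]
        exact hosc x hx y hy)
    rw [hgK' x hxK', Real.dist_eq, convolution_lsmul_swap] at h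
    rw [convolution_lsmul]
    simpa only [smul_eq_mul, mul_comm] using h
  · rw [laplacian_convolution hgi.locallyIntegrable hρ hρc]
    set φ : 𝔼 → ℝ := fun t => ρ (x - t) with hφdef
    have hφ : ContDiff ℝ (⊤ : ℕ∞) φ := hρ.comp (contDiff_const.sub contDiff_id)
    have hφ0 : ∀ t, 0 ≤ φ t := fun t => b.nonneg_normed _
    have hφball : ∀ t, φ t ≠ 0 → t ∈ Metric.ball x ε := by
      intro t ht
      have h : x - t ∈ Function.support ρ := ht
      rw [hρdef, b.support_normed_eq, mem_ball_zero_iff] at h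
      rwa [mem_ball_iff_norm, norm_sub_rev]
    have hφs : tsupport φ ⊆ Metric.closedBall x ε :=
      closure_minimal (fun t ht => Metric.ball_subset_closedBall (hφball t ht))
        Metric.isClosed_closedBall
    have hφK' : tsupport φ ⊆ K' := hφs.trans (hball x hx)
    have hφc : HasCompactSupport φ :=
      (isCompact_closedBall x ε).of_isClosed_subset (isClosed_tsupport φ) hφs
    have hweak := hu.2 φ ⟨hφ, hφc, hφK'.trans hrΩ⟩ hφ0
    rw [setIntegral_weak_eq hq hpos hφ hφK' hrΩ hΩ.measurableSet hK'c.measurableSet] at hweak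
    have hucq : ContinuousOn (fun t => u t ^ q * φ t) K' :=
      (hcont'.rpow_const fun _ _ => Or.inr (by linarith)).mul hφ.continuous.continuousOn
    have hI1 : IntegrableOn (fun t => u t * laplacian φ t) K' :=
      (hcont'.mul (continuous_laplacian hφ).continuousOn).integrableOn_compact hK'c
    have hI2 : IntegrableOn (fun t => u t ^ q * φ t) K' := hucq.integrableOn_compact hK'c
    simp only [neg_mul] at hweak
    have hI1' : IntegrableOn (fun t => -(u t * laplacian φ t)) K' := hI1.neg
    rw [integral_add hI1' hI2, integral_neg] at hweak
    have hleft : ∫ t, g t * laplacian ρ (x - t) = ∫ t in K', u t * laplacian φ t := by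
      rw [← integral_indicator hK'c.measurableSet]
      refine integral_congr_ae (Eventually.of_forall fun t => ?_)
      beta_reduce
      rw [← laplacian_comp_const_sub hρ x t]
      by_cases ht : t ∈ K'
      · rw [hgK' t ht, indicator_of_mem ht]
      · rw [hg, indicator_of_notMem ht, indicator_of_notMem ht, zero_mul]
    have hφ1 : ∫ t in K', φ t = 1 := by
      rw [setIntegral_eq_integral_of_forall_compl_eq_zero
        (fun t ht => image_eq_zero_of_notMem_tsupport fun h => ht (hφK' h))]
      exact (integral_sub_left_eq_self ρ volume x).trans b.integral_normed
    have hlow : (max (u x - η) 0) ^ q ≤ ∫ t in K', u t ^ q * φ t := by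
      calc (max (u x - η) 0) ^ q = ∫ t in K', (max (u x - η) 0) ^ q * φ t := by
            rw [integral_const_mul, hφ1, mul_one]
        _ ≤ _ := by
            refine setIntegral_mono_on
              ((hφ.continuous.continuousOn.integrableOn_compact hK'c).const_mul _) hI2
              hK'c.measurableSet fun t ht => ?_
            by_cases h0 : φ t = 0
            · simp [h0]
            · refine mul_le_mul_of_nonneg_right ?_ (hφ0 t)
              refine Real.rpow_le_rpow (le_max_right _ _) (max_le ?_ (hpos t (hrΩ ht)))
                (by linarith)
              have := hosc x hx t (hφball t h0)
              rw [Real.dist_eq] at this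
              linarith [(abs_le.1 this).1]
    rw [hleft]
    linarith

lemma SmoothApprox.weak_le {q : ℝ} (hq : 1 < q) {K : Set 𝔼} (hK : IsCompact K) {u φ : 𝔼 → ℝ}
    (hcont : ContinuousOn u K) (hpos : ∀ x ∈ K, 0 ≤ u x) (hu : SmoothApprox q K u)
    (hφ : ContDiff ℝ (⊤ : ℕ∞) φ) (hφ0 : ∀ x, 0 ≤ φ x) (hφK : tsupport φ ⊆ K) :
    ∫ x in K, (-(u x) * laplacian φ x + u x ^ q * φ x) ≤ 0 := by
  have hφc : HasCompactSupport φ := hK.of_isClosed_subset (isClosed_tsupport φ) hφK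
  set η : ℕ → ℝ := fun n => 1 / ((n : ℝ) + 1) with hη
  have hη0 : ∀ n, 0 < η n := fun n => by positivity
  have hη1 : ∀ n, η n ≤ 1 := fun n => by
    rw [hη]
    exact div_le_one_of_le₀ (by linarith [(Nat.cast_nonneg n : (0 : ℝ) ≤ n)]) (by positivity)
  have hηt : Tendsto η atTop (nhds 0) := tendsto_one_div_add_atTop_nhds_zero_nat
  choose w hw hwu using fun n => hu (η n) (hη0 n)
  have hmc : ∀ n, ContinuousOn (fun x => (max (u x - η n) 0) ^ q) K := fun n =>
    ((hcont.sub continuousOn_const).sup continuousOn_const).rpow_const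
      fun _ _ => Or.inr (by linarith)
  have hΔ := (continuous_laplacian hφ).continuousOn (s := K)
  have hφC := hφ.continuous.continuousOn (s := K)
  have hn : ∀ n, ∫ x in K, (-(w n x) * laplacian φ x + (max (u x - η n) 0) ^ q * φ x) ≤ 0 := by
    intro n
    have hI1 : IntegrableOn (fun x => w n x * laplacian φ x) K :=
      ((hw n).continuous.continuousOn.mul hΔ).integrableOn_compact hK
    have hI2 : IntegrableOn (fun x => (max (u x - η n) 0) ^ q * φ x) K :=
      ((hmc n).mul hφC).integrableOn_compact hK
    have hI3 : IntegrableOn (fun x => laplacian (w n) x * φ x) K :=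
      ((continuous_laplacian (hw n)).continuousOn.mul hφC).integrableOn_compact hK
    have h1 := integral_mul_laplacian (hw n) hφ hφc
    have e1 : ∫ t in K, w n t * laplacian φ t = ∫ t, w n t * laplacian φ t :=
      setIntegral_eq_integral_of_forall_compl_eq_zero fun t ht => by
        rw [laplacian_eq_zero_of_notMem_tsupport hφ fun h => ht (hφK h), mul_zero]
    have e2 : ∫ t in K, laplacian (w n) t * φ t = ∫ t, laplacian (w n) t * φ t :=
      setIntegral_eq_integral_of_forall_compl_eq_zero fun t ht => by
        rw [image_eq_zero_of_notMem_tsupport fun h => ht (hφK h), mul_zero]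
    rw [← e1, ← e2] at h1
    have h2 := setIntegral_mono_on hI2 hI3 hK.measurableSet fun x hx =>
      mul_le_mul_of_nonneg_right (hwu n x hx).2 (hφ0 x)
    simp only [neg_mul]
    have hI1' : IntegrableOn (fun x => -(w n x * laplacian φ x)) K := hI1.neg
    rw [integral_add hI1' hI2, integral_neg]
    linarith
  refine le_of_tendsto (tendsto_integral_of_dominated_convergence
    (fun x => (u x + 1) * |laplacian φ x| + u x ^ q * φ x) (fun n => ?_) ?_ (fun n => ?_) ?_)
    (Eventually.of_forall hn)
  · exact (((hw n).continuous.continuousOn.neg.mul hΔ).add ((hmc n).mul hφC)).aestronglyMeasurable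
      hK.measurableSet
  · exact (((hcont.add continuousOn_const).mul hΔ.abs).add
      ((hcont.rpow_const fun _ _ => Or.inr (by linarith)).mul hφC)).integrableOn_compact hK
  · filter_upwards [ae_restrict_mem hK.measurableSet] with x hx
    have hux := hpos x hx
    have h1 : |w n x| ≤ u x + 1 := by
      have h := abs_le.1 (hwu n x hx).1
      have := hη1 n
      rw [abs_le]
      constructor <;> linarith
    have h2 : (max (u x - η n) 0) ^ q ≤ u x ^ q :=
      Real.rpow_le_rpow (le_max_right _ _) (max_le (by linarith [hη0 n]) hux) (by linarith)
    refine (norm_add_le _ _).trans (add_le_add ?_ ?_)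
    · rw [Real.norm_eq_abs, abs_mul, abs_neg]
      gcongr
    · rw [Real.norm_eq_abs, abs_of_nonneg (mul_nonneg (by positivity) (hφ0 x))]
      exact mul_le_mul_of_nonneg_right h2 (hφ0 x)
  · filter_upwards [ae_restrict_mem hK.measurableSet] with x hx
    have h1 : Tendsto (fun n => w n x) atTop (nhds (u x)) := by
      rw [tendsto_iff_dist_tendsto_zero]
      exact squeeze_zero (fun _ => dist_nonneg) (fun n => (hwu n x hx).1) hηt
    have h2 : Tendsto (fun n => max (u x - η n) 0) atTop (nhds (u x)) := by
      have := (hηt.const_sub (u x)).max (tendsto_const_nhds (x := (0 : ℝ)))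
      rwa [sub_zero, max_eq_left (hpos x hx)] at this
    exact (h1.neg.mul_const _).add ((h2.rpow_const (Or.inr (by linarith))).mul_const _)

/-- Nonnegative continuous subsolutions are locally bounded by a constant depending only on the
compact set. -/
lemma exists_forall_subsolution_le {q : ℝ} (hq : 1 < q) {Ω K : Set 𝔼} (hΩ : IsOpen Ω)
    (hK : IsCompact K) (hKΩ : K ⊆ Ω) :
    ∃ M : ℝ, ∀ x ∈ K, ∀ u : 𝔼 → ℝ, ContinuousOn u Ω → (∀ x ∈ Ω, 0 ≤ u x) →
      IsSubsolution q Ω u → u x ≤ M := by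
  obtain ⟨C, m, hC, hm, hbar⟩ := exists_barrier_constants N hq
  refine hK.induction_on (p := fun s => ∃ M : ℝ, ∀ x ∈ s, ∀ u : 𝔼 → ℝ, ContinuousOn u Ω →
    (∀ x ∈ Ω, 0 ≤ u x) → IsSubsolution q Ω u → u x ≤ M) ⟨0, by simp⟩ ?_ ?_ ?_
  · rintro s t hst ⟨M, hM⟩
    exact ⟨M, fun x hx => hM x (hst hx)⟩
  · rintro s t ⟨M, hM⟩ ⟨M', hM'⟩
    refine ⟨max M M', ?_⟩
    rintro x (hx | hx) u h1 h2 h3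
    · exact (hM x hx u h1 h2 h3).trans (le_max_left _ _)
    · exact (hM' x hx u h1 h2 h3).trans (le_max_right _ _)
  · intro x₀ hx₀
    obtain ⟨r, hr, hrΩ⟩ := Metric.nhds_basis_closedBall.mem_iff.1 (hΩ.mem_nhds (hKΩ hx₀))
    set R := min r 1 with hR
    have hR0 : 0 < R := lt_min hr one_pos
    have hRΩ : Metric.closedBall x₀ R ⊆ Ω :=
      (Metric.closedBall_subset_closedBall (min_le_left _ _)).trans hrΩ
    refine ⟨Metric.ball x₀ (R / 2),
      mem_nhdsWithin_of_mem_nhds (Metric.ball_mem_nhds _ (by positivity)),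
      C * (R ^ 2 - (R / 2) ^ 2)⁻¹ ^ m, fun x hx u h1 h2 h3 => ?_⟩
    have h := (h3.smoothApprox hq hΩ (isCompact_closedBall x₀ R) hRΩ h1 h2).le_barrier hq hC hbar
      hm hR0 (min_le_right _ _) (Metric.ball_subset_ball (by linarith) hx)
    refine h.trans ?_
    have hx' : ‖x - x₀‖ < R / 2 := mem_ball_iff_norm.1 hx
    have h5 : 0 < R ^ 2 - (R / 2) ^ 2 := by nlinarith
    have h6 : R ^ 2 - (R / 2) ^ 2 ≤ R ^ 2 - ‖x - x₀‖ ^ 2 := by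
      gcongr
    have h7 : 0 < R ^ 2 - ‖x - x₀‖ ^ 2 := h5.trans_le h6
    gcongr

lemma partialSups_nonneg_and_smoothApprox {q : ℝ} (hq : 1 < q) {K : Set 𝔼}
    {u : ℕ → 𝔼 → ℝ} (hpos : ∀ k, ∀ x ∈ K, 0 ≤ u k x)
    (hu : ∀ k, SmoothApprox q K (u k)) (n : ℕ) :
    (∀ x ∈ K, 0 ≤ partialSups u n x) ∧ SmoothApprox q K (partialSups u n) := by
  induction n with
  | zero => simpa using ⟨hpos 0, hu 0⟩
  | succ n ih =>
    rw [partialSups_add_one]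
    exact ⟨fun x hx => (ih.1 x hx).trans le_sup_left,
      SmoothApprox.sup hq.le ih.1 (hpos (n + 1)) ih.2 (hu (n + 1))⟩

end Mollification

theorem stmt8 {N : ℕ} (hN : 2 ≤ N) (q : ℝ) (hq : ((N : ℝ) + 1) / ((N : ℝ) - 1) ≤ q)
    (Ω : Set (EuclideanSpace ℝ (Fin N))) (hΩ : IsOpen Ω) (hΩne : Ω.Nonempty)
    (u : ℕ → EuclideanSpace ℝ (Fin N) → ℝ)
    (hcont : ∀ k, ContinuousOn (u k) Ω)
    (hpos : ∀ k, ∀ x ∈ Ω, 0 ≤ u k x)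
    (hsub : ∀ k, IsSubsolution q Ω (u k)) :
    (∀ x ∈ Ω, BddAbove (Set.range fun k => u k x)) ∧
    (∀ K : Set (EuclideanSpace ℝ (Fin N)), K ⊆ Ω → IsCompact K →
      ∃ M : ℝ, ∀ x ∈ K, (⨆ k, u k x) ≤ M) ∧
    IsSubsolution q Ω (fun x => ⨆ k, u k x) := by
  have hq1 : 1 < q := by
    have hN' : (2 : ℝ) ≤ N := by exact_mod_cast hN
    refine lt_of_lt_of_le ?_ hq
    rw [one_lt_div (by linarith)]
    linarith
  have hbound : ∀ K : Set (EuclideanSpace ℝ (Fin N)), K ⊆ Ω → IsCompact K →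
      ∃ M : ℝ, ∀ x ∈ K, ∀ k, u k x ≤ M := by
    intro K hKΩ hK
    obtain ⟨M, hM⟩ := exists_forall_subsolution_le hq1 hΩ hK hKΩ
    exact ⟨M, fun x hx k => hM x hx (u k) (hcont k) (hpos k) (hsub k)⟩
  have hbdd : ∀ x ∈ Ω, BddAbove (Set.range fun k => u k x) := by
    intro x hx
    obtain ⟨M, hM⟩ := hbound {x} (singleton_subset_iff.2 hx) isCompact_singleton
    exact ⟨M, by rintro _ ⟨k, rfl⟩; exact hM x rfl k⟩
  have hU0 : ∀ x ∈ Ω, 0 ≤ ⨆ k, u k x := fun x hx => Real.iSup_nonneg fun k => hpos k x hx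
  have hvc : ∀ n, ContinuousOn (partialSups u n) Ω := fun n =>
    ContinuousOn.partialSups fun k _ => hcont k
  have hvt : ∀ x ∈ Ω, Tendsto (fun n => partialSups u n x) atTop (nhds (⨆ k, u k x)) := by
    intro x hx
    have h := tendsto_atTop_ciSup (partialSups fun k => u k x).monotone
      (bddAbove_range_partialSups.2 (hbdd x hx))
    rw [ciSup_partialSups_eq (hbdd x hx)] at h
    simpa only [Pi.partialSups_apply] using h
  have hvU : ∀ n, ∀ x ∈ Ω, partialSups u n x ≤ ⨆ k, u k x := by
    intro n x hx
    rw [Pi.partialSups_apply]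
    exact partialSups_le _ _ _ fun k _ => le_ciSup (hbdd x hx) k
  have hUm : AEStronglyMeasurable (fun x => ⨆ k, u k x) (volume.restrict Ω) :=
    aestronglyMeasurable_of_tendsto_ae atTop
      (fun n => (hvc n).aestronglyMeasurable hΩ.measurableSet)
      ((ae_restrict_mem hΩ.measurableSet).mono hvt)
  refine ⟨hbdd, fun K hKΩ hK => ?_, ⟨hUm, fun K hKΩ hK => ?_⟩, fun φ hφ hφ0 => ?_⟩
  · obtain ⟨M, hM⟩ := hbound K hKΩ hK
    exact ⟨M, fun x hx => ciSup_le fun k => hM x hx k⟩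
  · obtain ⟨M, hM⟩ := hbound K hKΩ hK
    refine IntegrableOn.of_bound hK.measure_lt_top ?_ (M ^ q) ?_
    · exact ((hUm.mono_measure (Measure.restrict_mono hKΩ le_rfl)).aemeasurable.abs.pow_const
        q).aestronglyMeasurable
    · filter_upwards [ae_restrict_mem hK.measurableSet] with x hx
      have h0 := hU0 x (hKΩ hx)
      rw [abs_of_nonneg h0, Real.norm_of_nonneg (by positivity)]
      exact Real.rpow_le_rpow h0 (ciSup_le fun k => hM x hx k) (by linarith)
  · obtain ⟨hφs, hφc, hφΩ⟩ := hφ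
    set K := tsupport φ with hKdef
    have hK : IsCompact K := hφc
    obtain ⟨M, hM⟩ := hbound K hφΩ hK
    rw [setIntegral_weak_eq hq1 hU0 hφs subset_rfl hφΩ hΩ.measurableSet hK.measurableSet]
    have hv := partialSups_nonneg_and_smoothApprox hq1
      (fun k x hx => hpos k x (hφΩ hx))
      (fun k => (hsub k).smoothApprox hq1 hΩ hK hφΩ (hcont k) (hpos k))
    have hΔ := (continuous_laplacian hφs).continuousOn (s := K)
    have hφC := hφs.continuous.continuousOn (s := K)
    refine le_of_tendsto (tendsto_integral_of_dominated_convergence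
      (fun x => M * |laplacian φ x| + M ^ q * φ x) (fun n => ?_) ?_ (fun n => ?_) ?_)
      (Eventually.of_forall fun n => (hv n).2.weak_le hq1 hK ((hvc n).mono hφΩ) (hv n).1 hφs hφ0
        subset_rfl)
    · have hvn := (hvc n).mono hφΩ
      exact ((hvn.neg.mul hΔ).add ((hvn.rpow_const fun _ _ => Or.inr (by linarith)).mul
        hφC)).aestronglyMeasurable hK.measurableSet
    · exact ((continuousOn_const.mul hΔ.abs).add
        (continuousOn_const.mul hφC)).integrableOn_compact hK
    · filter_upwards [ae_restrict_mem hK.measurableSet] with x hx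
      have h0 := (hv n).1 x hx
      have h1 : partialSups u n x ≤ M :=
        (hvU n x (hφΩ hx)).trans (ciSup_le fun k => hM x hx k)
      refine (norm_add_le _ _).trans (add_le_add ?_ ?_)
      · rw [Real.norm_eq_abs, abs_mul, abs_neg, abs_of_nonneg h0]
        gcongr
      · rw [Real.norm_of_nonneg (mul_nonneg (by positivity) (hφ0 x))]
        exact mul_le_mul_of_nonneg_right (Real.rpow_le_rpow h0 h1 (by linarith)) (hφ0 x)
    · filter_upwards [ae_restrict_mem hK.measurableSet] with x hx
      have h := hvt x (hφΩ hx)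
      exact (h.neg.mul_const _).add ((h.rpow_const (Or.inr (by linarith))).mul_const _)
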